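/- Let α, β ≥ 0, σ > 0, and V ∈ ℝ^{n×r}. The function U ↦ h_g(U) − ⟨V, U⟩, where h_g(U) = (α/4)‖U‖⁴ + (β/4)‖UᵀU‖² + (σ/2)‖U‖², has a unique global minimizer U* over ℝ^{n×r}, and U* is the unique solution of the equation ∇h_g(U) = V, i.e., of U·(α‖U‖²·I_r + β·UᵀU + σ·I_r) = V. -/

import Mathlib

open Matrix

attribute [local instance] Matrix.frobeniusNormedAddCommGroup Matrix.frobeniusNormedSpace

/-- Frobenius inner product `⟨X, Y⟩ = Tr(Xᵀ Y)`. -/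
noncomputable def minner {n r : ℕ} (X Y : Matrix (Fin n) (Fin r) ℝ) : ℝ := (Xᵀ * Y).trace

/-- The Gram kernel `h_g(X) = (α/4)‖X‖⁴ + (β/4)‖XᵀX‖² + (σ/2)‖X‖²` (Frobenius norms). -/
noncomputable def hg {n r : ℕ} (α β σ : ℝ) (X : Matrix (Fin n) (Fin r) ℝ) : ℝ :=
  α / 4 * ‖X‖ ^ 4 + β / 4 * ‖Xᵀ * X‖ ^ 2 + σ / 2 * ‖X‖ ^ 2


lemma mi_sq {n r : ℕ} (X : Matrix (Fin n) (Fin r) ℝ) : ‖X‖ ^ 2 = minner X X := by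
  rw [Matrix.frobenius_norm_def, ← Real.sqrt_eq_rpow, Real.sq_sqrt (by positivity)]
  simp only [minner, Matrix.trace, Matrix.diag, Matrix.mul_apply, Matrix.transpose_apply]
  rw [Finset.sum_comm]
  refine Finset.sum_congr rfl fun i _ => Finset.sum_congr rfl fun j _ => ?_
  norm_num
  ring

lemma mi_add_left {n r : ℕ} (X Y Z : Matrix (Fin n) (Fin r) ℝ) :
    minner (X + Y) Z = minner X Z + minner Y Z := by
  simp [minner, Matrix.add_mul]

lemma mi_sub_left {n r : ℕ} (X Y Z : Matrix (Fin n) (Fin r) ℝ) :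
    minner (X - Y) Z = minner X Z - minner Y Z := by
  simp [minner, Matrix.sub_mul]

lemma mi_smul_left {n r : ℕ} (c : ℝ) (X Z : Matrix (Fin n) (Fin r) ℝ) :
    minner (c • X) Z = c * minner X Z := by
  simp [minner]

lemma mi_comm {n r : ℕ} (X Y : Matrix (Fin n) (Fin r) ℝ) : minner X Y = minner Y X := by
  unfold minner
  rw [← Matrix.trace_transpose, Matrix.transpose_mul, Matrix.transpose_transpose]

lemma mi_add_right {n r : ℕ} (X Y Z : Matrix (Fin n) (Fin r) ℝ) :
    minner Z (X + Y) = minner Z X + minner Z Y := by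
  simp [minner, Matrix.mul_add]

lemma mi_smul_right {n r : ℕ} (c : ℝ) (X Z : Matrix (Fin n) (Fin r) ℝ) :
    minner Z (c • X) = c * minner Z X := by
  simp [minner]

lemma mi_sub_right {n r : ℕ} (X Y Z : Matrix (Fin n) (Fin r) ℝ) :
    minner Z (X - Y) = minner Z X - minner Z Y := by
  simp [minner, Matrix.mul_sub]

noncomputable def gG {n r : ℕ} (α β σ : ℝ) (U : Matrix (Fin n) (Fin r) ℝ) :
    Matrix (Fin n) (Fin r) ℝ :=
  U * ((α * ‖U‖ ^ 2) • (1 : Matrix (Fin r) (Fin r) ℝ) + β • (Uᵀ * U) +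
        σ • (1 : Matrix (Fin r) (Fin r) ℝ))

lemma gG_inner {n r : ℕ} (α β σ : ℝ) (U E : Matrix (Fin n) (Fin r) ℝ) :
    minner (gG α β σ U) E = α * minner U U * minner U E + β * minner (Uᵀ * U) (Uᵀ * E)
      + σ * minner U E := by
  unfold gG
  rw [mi_sq, Matrix.mul_add, Matrix.mul_add, Matrix.mul_smul, Matrix.mul_smul, Matrix.mul_smul,
    Matrix.mul_one, mi_add_left, mi_add_left, mi_smul_left, mi_smul_left, mi_smul_left]
  congr 3
  simp [minner, Matrix.mul_assoc]

lemma hg_eq {n r : ℕ} (α β σ : ℝ) (U : Matrix (Fin n) (Fin r) ℝ) :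
    hg α β σ U = α / 4 * (minner U U) ^ 2 + β / 4 * minner (Uᵀ * U) (Uᵀ * U)
      + σ / 2 * minner U U := by
  unfold hg
  rw [← mi_sq, ← mi_sq]; ring

lemma taylor {n r : ℕ} (α β σ : ℝ) (U E : Matrix (Fin n) (Fin r) ℝ) :
    hg α β σ (U + E) = hg α β σ U + minner (gG α β σ U) E
      + α / 4 * ((2 * minner U E + minner E E) ^ 2 + 2 * minner U U * minner E E)
      + β / 4 * (minner (Uᵀ * E + Eᵀ * U + Eᵀ * E) (Uᵀ * E + Eᵀ * U + Eᵀ * E)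
          + 2 * minner (E * Uᵀ) (E * Uᵀ))
      + σ / 2 * minner E E := by
  have h1 : (U + E)ᵀ * (U + E) = Uᵀ * U + (Uᵀ * E + Eᵀ * U + Eᵀ * E) := by
    rw [Matrix.transpose_add, Matrix.add_mul, Matrix.mul_add, Matrix.mul_add]; abel
  have h2 : minner (Uᵀ * U) (Eᵀ * U) = minner (Uᵀ * U) (Uᵀ * E) := by
    unfold minner
    rw [← Matrix.trace_transpose, Matrix.transpose_mul, Matrix.trace_mul_comm]
    simp
  have h3 : minner (E * Uᵀ) (E * Uᵀ) = minner (Uᵀ * U) (Eᵀ * E) := by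
    unfold minner
    simp only [Matrix.transpose_mul, Matrix.transpose_transpose, Matrix.mul_assoc]
    rw [Matrix.trace_mul_comm Uᵀ]
    simp only [Matrix.mul_assoc]
  rw [hg_eq, hg_eq, gG_inner, h1, h3]
  have h4 : minner (Uᵀ * U + (Uᵀ * E + Eᵀ * U + Eᵀ * E)) (Uᵀ * U + (Uᵀ * E + Eᵀ * U + Eᵀ * E))
     = minner (Uᵀ * U) (Uᵀ * U) + 2 * (2 * minner (Uᵀ * U) (Uᵀ * E) + minner (Uᵀ * U) (Eᵀ * E))
      + minner (Uᵀ * E + Eᵀ * U + Eᵀ * E) (Uᵀ * E + Eᵀ * U + Eᵀ * E) := by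
    rw [mi_add_left, mi_add_right, mi_add_right (Uᵀ * U), mi_comm (_ + _) (Uᵀ * U),
      mi_add_right _ _ (Uᵀ * U), mi_add_right _ _ (Uᵀ * U), h2]
    ring
  have h5 : minner (U + E) (U + E) = minner U U + (2 * minner U E + minner E E) := by
    rw [mi_add_left, mi_add_right, mi_add_right, mi_comm E U]; ring
  rw [h4, h5]
  ring

lemma mi_nonneg {n r : ℕ} (X : Matrix (Fin n) (Fin r) ℝ) : 0 ≤ minner X X := by
  rw [← mi_sq]; positivity

lemma strong {n r : ℕ} (α β σ : ℝ) (hα : 0 ≤ α) (hβ : 0 ≤ β)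
    (U W : Matrix (Fin n) (Fin r) ℝ) :
    hg α β σ U - minner (gG α β σ U) U + σ / 2 * ‖W - U‖ ^ 2
      ≤ hg α β σ W - minner (gG α β σ U) W := by
  have h := taylor α β σ U (W - U)
  rw [add_sub_cancel, mi_sub_right _ _ (gG α β σ U)] at h
  rw [mi_sq, h]
  have a1 := mi_nonneg U
  have a2 := mi_nonneg (W - U)
  have a3 := mi_nonneg (Uᵀ * (W - U) + (W - U)ᵀ * U + (W - U)ᵀ * (W - U))
  have a4 := mi_nonneg ((W - U) * Uᵀ)
  have b1 : 0 ≤ α / 4 * ((2 * minner U (W - U) + minner (W - U) (W - U)) ^ 2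
    + 2 * minner U U * minner (W - U) (W - U)) := by positivity
  have b2 := mul_nonneg (by positivity : 0 ≤ β / 4) (add_nonneg a3 (mul_nonneg zero_le_two a4))
  linarith

lemma hg_cont {n r : ℕ} (α β σ : ℝ) (V : Matrix (Fin n) (Fin r) ℝ) :
    Continuous fun U : Matrix (Fin n) (Fin r) ℝ => hg α β σ U - minner V U := by
  have h1 : Continuous fun U : Matrix (Fin n) (Fin r) ℝ => Uᵀ * U :=
    Continuous.matrix_mul (continuous_id.matrix_transpose) continuous_id
  have h2 : Continuous fun U : Matrix (Fin n) (Fin r) ℝ => minner V U :=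
    (continuous_const.matrix_mul continuous_id).matrix_trace
  have h3 : Continuous fun U : Matrix (Fin n) (Fin r) ℝ => ‖Uᵀ * U‖ := continuous_norm.comp h1
  have h4 : Continuous fun U : Matrix (Fin n) (Fin r) ℝ => ‖U‖ := continuous_norm
  unfold hg
  exact (((continuous_const.mul (h4.pow 4)).add (continuous_const.mul (h3.pow 2))).add
    (continuous_const.mul (h4.pow 2))).sub h2

lemma coer {n r : ℕ} (α β σ : ℝ) (hα : 0 ≤ α) (hβ : 0 ≤ β) (hσ : 0 < σ)
    (V U : Matrix (Fin n) (Fin r) ℝ) :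
    σ / 4 * ‖U‖ ^ 2 - ‖V‖ ^ 2 / σ ≤ hg α β σ U - minner V U := by
  have h := mi_nonneg ((σ / 2) • U - V)
  rw [mi_sub_left, mi_sub_right, mi_sub_right, mi_smul_left, mi_smul_left, mi_smul_right,
    mi_smul_right, mi_comm U V, ← mi_sq, ← mi_sq] at h
  have h2 : minner V U ≤ σ / 4 * ‖U‖ ^ 2 + ‖V‖ ^ 2 / σ := by
    have : minner V U * σ ≤ (σ / 4 * ‖U‖ ^ 2 + ‖V‖ ^ 2 / σ) * σ := by
      have : (σ / 4 * ‖U‖ ^ 2 + ‖V‖ ^ 2 / σ) * σ = σ ^ 2 / 4 * ‖U‖ ^ 2 + ‖V‖ ^ 2 := by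
        field_simp
      rw [this]; linarith
    exact le_of_mul_le_mul_right this hσ
  unfold hg
  have : 0 ≤ α / 4 * ‖U‖ ^ 4 := by positivity
  have : 0 ≤ β / 4 * ‖Uᵀ * U‖ ^ 2 := by positivity
  linarith

lemma exists_min {n r : ℕ} (α β σ : ℝ) (hα : 0 ≤ α) (hβ : 0 ≤ β) (hσ : 0 < σ)
    (V : Matrix (Fin n) (Fin r) ℝ) :
    ∃ U, ∀ W, hg α β σ U - minner V U ≤ hg α β σ W - minner V W := by
  haveI : ProperSpace (Matrix (Fin n) (Fin r) ℝ) := FiniteDimensional.proper ℝ _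
  refine (hg_cont α β σ V).exists_forall_le ?_
  refine Filter.tendsto_atTop_mono (coer α β σ hα hβ hσ V) ?_
  refine Filter.tendsto_atTop_add_const_right _ _ ?_
  refine Filter.Tendsto.const_mul_atTop (by positivity) ?_
  exact (Filter.tendsto_pow_atTop two_ne_zero).comp (tendsto_norm_cocompact_atTop)

lemma crit {n r : ℕ} (α β σ : ℝ) (V U : Matrix (Fin n) (Fin r) ℝ)
    (h : ∀ W, hg α β σ U - minner V U ≤ hg α β σ W - minner V W) : gG α β σ U = V := by
  set D := V - gG α β σ U with hD
  have key : ∃ A B C : ℝ, ∀ t : ℝ, hg α β σ (U + t • D) - minner V (U + t • D) =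
      hg α β σ U - minner V U - t * ‖D‖ ^ 2 + t ^ 2 * (A + B * t + C * t ^ 2) := by
    let S := Uᵀ * D + Dᵀ * U
    let N := Dᵀ * D
    refine ⟨α / 4 * (4 * minner U D ^ 2 + 2 * minner U U * minner D D) + β / 4 * (minner S S +
        2 * minner (D * Uᵀ) (D * Uᵀ)) + σ / 2 * minner D D,
      α * minner U D * minner D D + β / 2 * minner S N,
      α / 4 * minner D D ^ 2 + β / 4 * minner N N, fun t => ?_⟩
    have e1 : Uᵀ * (t • D) + (t • D)ᵀ * U + (t • D)ᵀ * (t • D) = t • S + (t ^ 2) • N := by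
      simp only [S, N, Matrix.transpose_smul, Matrix.mul_smul, Matrix.smul_mul, smul_add, smul_smul,
        pow_two]
    have e2 : ‖D‖ ^ 2 = minner V D - minner (gG α β σ U) D := by
      rw [mi_sq, ← mi_sub_left]
    rw [taylor, e1, e2]
    simp only [mi_add_left, mi_add_right, mi_smul_left, mi_smul_right, Matrix.smul_mul, mi_comm N S]
    ring
  obtain ⟨A, B, C, key⟩ := key
  have h0 : ‖D‖ ^ 2 ≤ 0 := by
    have hlim : Filter.Tendsto (fun t : ℝ => t * (A + B * t + C * t ^ 2))
        (nhdsWithin 0 (Set.Ioi 0)) (nhds 0) := by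
      have : Continuous fun t : ℝ => t * (A + B * t + C * t ^ 2) := by fun_prop
      simpa using (this.tendsto 0).mono_left nhdsWithin_le_nhds
    refine ge_of_tendsto hlim ?_
    filter_upwards [self_mem_nhdsWithin] with t ht
    have ht : 0 < t := ht
    have h1 := h (U + t • D)
    rw [key] at h1
    have : t * ‖D‖ ^ 2 ≤ t * (t * (A + B * t + C * t ^ 2)) := by nlinarith
    exact le_of_mul_le_mul_left this ht
  have h1 : ‖D‖ = 0 := by
    have := sq_nonneg ‖D‖
    exact pow_eq_zero_iff two_ne_zero |>.1 (le_antisymm h0 this)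
  exact (sub_eq_zero.1 (norm_eq_zero.1 h1)).symm

/-- For any `V`, the function `U ↦ h_g(U) − ⟨V, U⟩` has a unique global
minimizer `U*`, and `U*` is the unique solution of `∇h_g(U) = V`, i.e. of
`U (α‖U‖² I_r + β UᵀU + σ I_r) = V`. -/
theorem gram_kernel_unique_minimizer {n r : ℕ} (α β σ : ℝ) (hα : 0 ≤ α) (hβ : 0 ≤ β)
    (hσ : 0 < σ) (V : Matrix (Fin n) (Fin r) ℝ) :
    ∃ Ustar : Matrix (Fin n) (Fin r) ℝ,
      (∀ W, hg α β σ Ustar - minner V Ustar ≤ hg α β σ W - minner V W) ∧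
      (∀ W, hg α β σ W - minner V W ≤ hg α β σ Ustar - minner V Ustar → W = Ustar) ∧
      Ustar * ((α * ‖Ustar‖ ^ 2) • (1 : Matrix (Fin r) (Fin r) ℝ) + β • (Ustarᵀ * Ustar) +
        σ • (1 : Matrix (Fin r) (Fin r) ℝ)) = V ∧
      (∀ W : Matrix (Fin n) (Fin r) ℝ,
        W * ((α * ‖W‖ ^ 2) • (1 : Matrix (Fin r) (Fin r) ℝ) + β • (Wᵀ * W) +
          σ • (1 : Matrix (Fin r) (Fin r) ℝ)) = V → W = Ustar) := by
  obtain ⟨U, hU⟩ := exists_min α β σ hα hβ hσ V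
  have hG := crit α β σ V U hU
  have huniq : ∀ W, hg α β σ W - minner V W ≤ hg α β σ U - minner V U → W = U := by
    intro W hW
    have h := strong α β σ hα hβ U W
    rw [hG] at h
    have h2 : σ / 2 * ‖W - U‖ ^ 2 ≤ 0 := by linarith
    have h3 : ‖W - U‖ ^ 2 ≤ 0 := nonpos_of_mul_nonpos_right h2 (by positivity)
    have h4 : ‖W - U‖ = 0 :=
      pow_eq_zero_iff two_ne_zero |>.1 (le_antisymm h3 (sq_nonneg _))
    exact sub_eq_zero.1 (norm_eq_zero.1 h4)
  refine ⟨U, hU, huniq, hG, fun W hW => huniq W ?_⟩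
  have hW' : gG α β σ W = V := hW
  have h := strong α β σ hα hβ W U
  rw [hW'] at h
  have : 0 ≤ σ / 2 * ‖U - W‖ ^ 2 := by positivity
  linarith
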